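/- Suppose G contains a contracting element and there exists an ω-dimensional G-equivariant conformal density on ∂_hY for some ω > 0. Then there is K > 0 such that #{g ∈ G : d(o,go) ≤ n} ≤ K·e^{ωn} for all n ≥ 0; in particular ω ≥ ω_G. -/

import Mathlib

open Metric Filter Topology Set MeasureTheory Pointwise

noncomputable section

namespace ConfDyn

/-- `γ` is (the image of) a geodesic segment from `x` to `y`. -/
def IsGeodesicIn (Y : Type*) [MetricSpace Y] (γ : Set Y) (x y : Y) : Prop :=
  ∃ f : ℝ → Y, f 0 = x ∧ f (dist x y) = y ∧
    (∀ s ∈ Set.Icc (0 : ℝ) (dist x y), ∀ t ∈ Set.Icc (0 : ℝ) (dist x y),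
      dist (f s) (f t) = |s - t|) ∧
    γ = f '' Set.Icc (0 : ℝ) (dist x y)

/-- `Y` is a geodesic metric space. -/
def GeodesicSpace (Y : Type*) [MetricSpace Y] : Prop :=
  ∀ x y : Y, ∃ γ : Set Y, IsGeodesicIn Y γ x y

/-- the shortest projection of the point `y` to the subset `X`. -/
def projSet {Y : Type*} [MetricSpace Y] (X : Set Y) (y : Y) : Set Y :=
  {x ∈ X | dist y x = Metric.infDist y X}

/-- the shortest projection of the subset `A` to the subset `X`. -/
def projSetOf {Y : Type*} [MetricSpace Y] (X A : Set Y) : Set Y :=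
  ⋃ a ∈ A, projSet X a

/-- `d_X(x,y)`, the diameter of `π_X(x) ∪ π_X(y)`. -/
def projDist {Y : Type*} [MetricSpace Y] (X : Set Y) (x y : Y) : ENNReal :=
  EMetric.diam (projSet X x ∪ projSet X y)

/-- `X` is a `C`-contracting subset: any geodesic segment at distance at least `C`
from `X` has shortest projection to `X` of diameter at most `C`. -/
def IsContractingSet {Y : Type*} [MetricSpace Y] (C : ℝ) (X : Set Y) : Prop :=
  ∀ x y : Y, ∀ γ : Set Y, IsGeodesicIn Y γ x y →
    (∀ p ∈ γ, C ≤ Metric.infDist p X) →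
    EMetric.diam (projSetOf X γ) ≤ ENNReal.ofReal C

/-- the Busemann function based at `o` associated to `y`, `b_y(x) = d(x,y) - d(o,y)`. -/
def busemannCM {Y : Type*} [MetricSpace Y] (o y : Y) : C(Y, ℝ) :=
  ⟨fun x => dist x y - dist o y,
    (continuous_id.dist continuous_const).sub continuous_const⟩

/-- the horofunction compactification of `Y`: the closure of `{b_y : y ∈ Y}` in
`C(Y,ℝ)` with the compact-open topology. -/
def horoCpt (Y : Type*) [MetricSpace Y] (o : Y) : Set C(Y, ℝ) :=
  closure (Set.range (busemannCM o))

/-- `ξ` is a point of the horofunction boundary `∂_h Y`. -/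
def IsHoroPoint {Y : Type*} [MetricSpace Y] (o : Y) (ξ : C(Y, ℝ)) : Prop :=
  ξ ∈ horoCpt Y o ∧ ∀ y : Y, ξ ≠ busemannCM o y

/-- a sequence of points of `Y` converges to `ξ` in the horofunction compactification. -/
def HoroConv {Y : Type*} [MetricSpace Y] (o : Y) (u : ℕ → Y) (ξ : C(Y, ℝ)) : Prop :=
  Filter.Tendsto (fun n => busemannCM o (u n)) atTop (nhds ξ)

/-- two horofunctions have (K-)finite difference for some K. -/
def FinDiff {Y : Type*} [MetricSpace Y] (ξ η : C(Y, ℝ)) : Prop :=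
  ∃ K : ℝ, ∀ z : Y, |ξ z - η z| ≤ K

/-- the locus of a subset of the horofunction boundary. -/
def locus {Y : Type*} [MetricSpace Y] (o : Y) (Λ : Set C(Y, ℝ)) : Set C(Y, ℝ) :=
  {η | IsHoroPoint o η ∧ ∃ ξ ∈ Λ, FinDiff ξ η}

/-- the finite-difference relation as a setoid on `C(Y,ℝ)`. -/
def finDiffSetoid (Y : Type*) [MetricSpace Y] : Setoid C(Y, ℝ) where
  r := FinDiff
  iseqv := ⟨fun ξ => ⟨0, fun z => by simp⟩,
    fun h => h.imp (fun K hK z => by rw [abs_sub_comm]; exact hK z),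
    fun h₁ h₂ => by
      obtain ⟨K₁, hK₁⟩ := h₁
      obtain ⟨K₂, hK₂⟩ := h₂
      exact ⟨K₁ + K₂, fun z => (abs_sub_le _ _ _).trans (add_le_add (hK₁ z) (hK₂ z))⟩⟩

/-- the limit set of a subset `X ⊆ Y` in the horofunction boundary. -/
def limitSetOf {Y : Type*} [MetricSpace Y] (o : Y) (X : Set Y) : Set C(Y, ℝ) :=
  {ξ | IsHoroPoint o ξ ∧ ∃ u : ℕ → Y, (∀ n, u n ∈ X) ∧ HoroConv o u ξ}

/-- accumulation points of a sequence of points of `Y` in the horofunction boundary. -/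
def accPoints {Y : Type*} [MetricSpace Y] (o : Y) (u : ℕ → Y) : Set C(Y, ℝ) :=
  {ξ | IsHoroPoint o ξ ∧ ∃ φ : ℕ → ℕ, StrictMono φ ∧ HoroConv o (u ∘ φ) ξ}

/-- `X` is a quasi-geodesic: the image of a quasi-isometric embedding of a real interval. -/
def IsQuasiGeodesicSet {Y : Type*} [MetricSpace Y] (X : Set Y) : Prop :=
  ∃ (c : ℝ) (I : Set ℝ) (φ : ℝ → Y), 1 ≤ c ∧ I.OrdConnected ∧ X = φ '' I ∧
    ∀ s ∈ I, ∀ t ∈ I,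
      (1 / c) * |s - t| - c ≤ dist (φ s) (φ t) ∧ dist (φ s) (φ t) ≤ c * |s - t| + c

section GroupAction

variable {Y : Type*} [MetricSpace Y] {G : Type*} [Group G] [MulAction G Y]

/-- `G` acts by isometries on `Y`. -/
def IsometricAction (G Y : Type*) [Group G] [MulAction G Y] [MetricSpace Y] : Prop :=
  ∀ g : G, Isometry (fun y : Y => g • y)

/-- the action of `G` on `Y` is (metrically) proper. -/
def ProperAction (G Y : Type*) [Group G] [MulAction G Y] [MetricSpace Y] : Prop :=
  ∀ B : Set Y, Bornology.IsBounded B → Set.Finite {g : G | (g • B) ∩ B ≠ ∅}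

/-- `G` is non-elementary: no finite-index subgroup is trivial or infinite cyclic. -/
def NonElementary (G : Type*) [Group G] : Prop :=
  ∀ H : Subgroup G, H.index ≠ 0 → ∀ g : G, H ≠ Subgroup.zpowers g

/-- the orbit of `o` under the cyclic group generated by `f`. -/
def cyclicOrbit (o : Y) (f : G) : Set Y :=
  {y : Y | ∃ n : ℤ, y = f ^ n • o}

/-- `f` is a contracting element with `C`-contracting orbit: it has infinite order,
`n ↦ fⁿ • o` is a quasi-isometric embedding of `ℤ`, and `⟨f⟩ • o` is `C`-contracting. -/
def IsContractingElt (o : Y) (C : ℝ) (f : G) : Prop :=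
  (∀ n : ℤ, n ≠ 0 → f ^ n ≠ 1) ∧
  (∃ c : ℝ, 1 ≤ c ∧ ∀ m n : ℤ,
      (1 / c) * |(m : ℝ) - (n : ℝ)| - c ≤ dist (f ^ m • o) (f ^ n • o) ∧
      dist (f ^ m • o) (f ^ n • o) ≤ c * |(m : ℝ) - (n : ℝ)| + c) ∧
  IsContractingSet C (cyclicOrbit o f)

/-- `f` is a contracting element. -/
def IsContractingEltAny (o : Y) (f : G) : Prop :=
  ∃ C : ℝ, 1 ≤ C ∧ IsContractingElt o C f

/-- the elementary group `E(f)`: elements moving `⟨f⟩ • o` a finite Hausdorff distance. -/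
def EGroup (o : Y) (f : G) : Set G :=
  {g : G | EMetric.hausdorffEdist (g • cyclicOrbit o f) (cyclicOrbit o f) ≠ ⊤}

/-- the axis `Ax(f) = E(f) • o`. -/
def axisOf (o : Y) (f : G) : Set Y :=
  (fun g : G => g • o) '' EGroup o f

/-- the family of all `G`-translated axes of `h` and `k`. -/
def axesPairFam (o : Y) (h k : G) : Set (Set Y) :=
  {S | ∃ g : G, S = g • axisOf o h ∨ S = g • axisOf o k}

/-- `h` and `k` are independent contracting elements: the family of their translated
axes has bounded projection. -/
def IndepElts (o : Y) (h k : G) : Prop :=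
  ∃ B : ℝ, 0 < B ∧ ∀ U ∈ axesPairFam o h k, ∀ V ∈ axesPairFam o h k,
    U ≠ V → EMetric.diam (projSetOf U V) ≤ ENNReal.ofReal B

/-- the family of all `G`-translated axes of the triple `f₁, f₂, f₃`. -/
def axesTripleFam (o : Y) (f₁ f₂ f₃ : G) : Set (Set Y) :=
  {S | ∃ g : G, S = g • axisOf o f₁ ∨ S = g • axisOf o f₂ ∨ S = g • axisOf o f₃}

/-- `F = {f₁,f₂,f₃}` is an admissible triple with constants `C`, `B₀`: three pairwise
independent contracting elements whose translated axes are `C`-contracting with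
`B₀`-bounded projection. -/
def IsAdmissibleTriple (o : Y) (C B₀ : ℝ) (f₁ f₂ f₃ : G) : Prop :=
  f₁ ≠ f₂ ∧ f₁ ≠ f₃ ∧ f₂ ≠ f₃ ∧
  IsContractingEltAny o f₁ ∧ IsContractingEltAny o f₂ ∧ IsContractingEltAny o f₃ ∧
  IndepElts o f₁ f₂ ∧ IndepElts o f₁ f₃ ∧ IndepElts o f₂ f₃ ∧
  (∀ S ∈ axesTripleFam o f₁ f₂ f₃, IsContractingSet C S) ∧
  (∀ U ∈ axesTripleFam o f₁ f₂ f₃, ∀ V ∈ axesTripleFam o f₁ f₂ f₃,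
    U ≠ V → EMetric.diam (projSetOf U V) ≤ ENNReal.ofReal B₀)

/-- the geodesic `γ` contains an `(r,f)`-barrier at `g • o`. -/
def HasBarrier (o : Y) (r : ℝ) (f g : G) (γ : Set Y) : Prop :=
  Metric.infDist (g • o) γ ≤ r ∧ Metric.infDist ((g * f) • o) γ ≤ r

/-- the partial cone `Ω_x^F(g • o, r)`. -/
def partialCone (o x : Y) (f₁ f₂ f₃ : G) (g : G) (r : ℝ) : Set Y :=
  {z | ∃ γ : Set Y, IsGeodesicIn Y γ x z ∧
      (HasBarrier o r f₁ g γ ∨ HasBarrier o r f₂ g γ ∨ HasBarrier o r f₃ g γ)}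

/-- the partial shadow `Π_x^F(g • o, r)`: accumulation points of the partial cone in
the horofunction boundary. -/
def partialShadow (o x : Y) (f₁ f₂ f₃ : G) (g : G) (r : ℝ) : Set C(Y, ℝ) :=
  {ξ | IsHoroPoint o ξ ∧ ∃ u : ℕ → Y, (∀ n, u n ∈ partialCone o x f₁ f₂ f₃ g r) ∧
      HoroConv o u ξ}

/-- `ξ` is an `(r,F)`-conical point. -/
def IsConicalPt (o : Y) (f₁ f₂ f₃ : G) (r : ℝ) (ξ : C(Y, ℝ)) : Prop :=
  ∃ g₀ : G, Set.Infinite {g : G | ξ ∈ partialShadow o (g₀ • o) f₁ f₂ f₃ g r}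

/-- the usual cone `Ω_x(y,r)`. -/
def usualCone (x y : Y) (r : ℝ) : Set Y :=
  {z | ∃ γ : Set Y, IsGeodesicIn Y γ x z ∧ ∃ p ∈ γ, dist p y ≤ r}

/-- the usual shadow `Π_x(y,r)`. -/
def usualShadow (o x y : Y) (r : ℝ) : Set C(Y, ℝ) :=
  {ξ | IsHoroPoint o ξ ∧ ∃ u : ℕ → Y, (∀ n, u n ∈ usualCone x y r) ∧ HoroConv o u ξ}

/-- the set `Λ_c(G)` of conical points of the action. -/
def conicalSet (G : Type*) {Y : Type*} [Group G] [MulAction G Y] [MetricSpace Y]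
    (o : Y) : Set C(Y, ℝ) :=
  {ξ | ∃ r : ℝ, 0 < r ∧ ∃ g₀ : G, ∃ u : ℕ → G,
      Filter.Tendsto (fun n => dist o (u n • o)) atTop atTop ∧
      ∀ n, ξ ∈ usualShadow o (g₀ • o) (u n • o) r}

/-- the attracting fixed-point set `[h⁺]`: the locus of the accumulation points of
`{hⁿ o : n > 0}` in the horofunction boundary. -/
def attrFix (o : Y) (h : G) : Set C(Y, ℝ) :=
  locus o (accPoints o (fun n : ℕ => h ^ (n + 1) • o))

/-- the repelling fixed-point set `[h⁻]`. -/
def repFix (o : Y) (h : G) : Set C(Y, ℝ) :=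
  locus o (accPoints o (fun n : ℕ => h ^ (-(n + 1) : ℤ) • o))

/-- the limit set `Λ G y` of the orbit `G • y` in the horofunction boundary. -/
def orbitLimitSet (G : Type*) {Y : Type*} [Group G] [MulAction G Y] [MetricSpace Y]
    (o y : Y) : Set C(Y, ℝ) :=
  {ξ | IsHoroPoint o ξ ∧ ∃ u : ℕ → G,
      Filter.Tendsto (fun n => busemannCM o (u n • y)) atTop (nhds ξ)}

/-- the action of an isometry `g` on horofunctions. -/
def horoAct [ContinuousConstSMul G Y] (o : Y) (g : G) (ξ : C(Y, ℝ)) : C(Y, ℝ) :=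
  ⟨fun y => ξ (g⁻¹ • y) - ξ (g⁻¹ • o),
    (ξ.continuous.comp (continuous_const_smul g⁻¹)).sub continuous_const⟩

/-- the number of orbit points of `Γ ⊆ G` in the closed ball of radius `R` around `o`. -/
def orbitCount (G : Type*) {Y : Type*} [Group G] [MulAction G Y] [MetricSpace Y]
    (o : Y) (Γ : Set G) (R : ℝ) : ℕ :=
  Nat.card {g : G // g ∈ Γ ∧ dist o (g • o) ≤ R}

/-- the critical exponent `ω_Γ` of a subset `Γ ⊆ G`. -/
def critExp (G : Type*) {Y : Type*} [Group G] [MulAction G Y] [MetricSpace Y]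
    (o : Y) (Γ : Set G) : ℝ :=
  Filter.limsup (fun R : ℝ => Real.log (orbitCount G o Γ R) / R) atTop

/-- an `ω`-dimensional `G`-equivariant conformal density on the horofunction boundary:
a family of finite measures supported on `∂_h Y`, normalized at `o`, `G`-equivariant,
with conformal derivative `dμ_x/dμ_y(ξ) = e^{-ω·B_ξ(x,y)}`. -/
def IsConformalDensity (G : Type*) {Y : Type*} [Group G] [MulAction G Y] [MetricSpace Y]
    [ContinuousConstSMul G Y] [MeasurableSpace C(Y, ℝ)]
    (o : Y) (ω : ℝ) (μ : Y → MeasureTheory.Measure C(Y, ℝ)) : Prop :=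
  (∀ x : Y, MeasureTheory.IsFiniteMeasure (μ x)) ∧
  (∀ x : Y, μ x {ξ : C(Y, ℝ) | ¬ IsHoroPoint o ξ} = 0) ∧
  μ o Set.univ = 1 ∧
  (∀ g : G, ∀ x : Y, MeasureTheory.Measure.map (horoAct o g) (μ x) = μ (g • x)) ∧
  (∀ x y : Y, μ x = (μ y).withDensity
      (fun ξ : C(Y, ℝ) => ENNReal.ofReal (Real.exp (-ω * (ξ x - ξ y)))))

end GroupAction

/-! ### Nearest-point projections to contracting sets -/

/-- `p` is a nearest point of `X` to `x`. -/
def IsNearest {Y : Type*} [MetricSpace Y] (X : Set Y) (x p : Y) : Prop :=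
  p ∈ X ∧ ∀ a ∈ X, dist x p ≤ dist x a

lemma IsNearest.dist_eq_infDist {Y : Type*} [MetricSpace Y] {X : Set Y} {x p : Y}
    (h : IsNearest X x p) : dist x p = Metric.infDist x X :=
  le_antisymm ((Metric.le_infDist ⟨p, h.1⟩).2 fun a ha => h.2 a ha)
    (Metric.infDist_le_dist_of_mem h.1)

lemma IsNearest.mem_projSet {Y : Type*} [MetricSpace Y] {X : Set Y} {x p : Y}
    (h : IsNearest X x p) : p ∈ projSet X x :=
  ⟨h.1, h.dist_eq_infDist⟩

/-- A relation `π x p` (read: `p` is a projection of `x`) such that any two points with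
projections at distance at least `L` are joined, up to an additive error `D`, by a shortest
path through these projections. -/
structure IsCoarseProj {Y : Type*} [MetricSpace Y] (π : Y → Y → Prop) (L D : ℝ) : Prop where
  total : ∀ x, ∃ p, π x p
  detour : ∀ ⦃x y p q : Y⦄, π x p → π y q → L ≤ dist p q →
    dist x p + dist p q + dist q y ≤ dist x y + D

lemma IsContractingSet.dist_le_of_far {Y : Type*} [MetricSpace Y] {C : ℝ} {X : Set Y}
    (hC : 0 ≤ C) (hX : IsContractingSet C X) {f : ℝ → Y} {a b : ℝ} (hab : a ≤ b)
    (hf : ∀ s ∈ Set.Icc a b, ∀ t ∈ Set.Icc a b, dist (f s) (f t) = |s - t|)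
    (hfar : ∀ s ∈ Set.Icc a b, C ≤ Metric.infDist (f s) X)
    {p q : Y} (hp : IsNearest X (f a) p) (hq : IsNearest X (f b) q) : dist p q ≤ C := by
  have hd : dist (f a) (f b) = b - a := by
    rw [hf a ⟨le_rfl, hab⟩ b ⟨hab, le_rfl⟩, abs_sub_comm, abs_of_nonneg (by linarith)]
  have hgeo : IsGeodesicIn Y (f '' Set.Icc a b) (f a) (f b) := by
    refine ⟨fun s => f (a + s), by simp, by simp [hd], ?_, ?_⟩
    · rw [hd]
      intro s hs t ht
      rw [hf _ ⟨by linarith [hs.1], by linarith [hs.2]⟩ _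
        ⟨by linarith [ht.1], by linarith [ht.2]⟩]
      congr 1
      ring
    · rw [hd]
      ext y
      constructor
      · rintro ⟨s, hs, rfl⟩
        exact ⟨s - a, ⟨by linarith [hs.1], by linarith [hs.2]⟩, by simp⟩
      · rintro ⟨s, hs, rfl⟩
        exact ⟨a + s, ⟨by linarith [hs.1], by linarith [hs.2]⟩, rfl⟩
  have hdiam := hX _ _ _ hgeo (by rintro _ ⟨s, hs, rfl⟩; exact hfar s hs)
  have hmem : ∀ s ∈ Set.Icc a b, ∀ r, IsNearest X (f s) r →
      r ∈ projSetOf X (f '' Set.Icc a b) := fun s hs r hr =>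
    Set.mem_biUnion (Set.mem_image_of_mem f hs) hr.mem_projSet
  have hle := (Metric.edist_le_ediam_of_mem (hmem a ⟨le_rfl, hab⟩ p hp)
    (hmem b ⟨hab, le_rfl⟩ q hq)).trans hdiam
  rw [edist_dist] at hle
  exact (ENNReal.ofReal_le_ofReal_iff hC).1 hle

lemma IsContractingSet.isCoarseProj {Y : Type*} [MetricSpace Y] (hY : GeodesicSpace Y)
    {C : ℝ} {X : Set Y} (hC : 0 ≤ C) (hX : IsContractingSet C X)
    (htot : ∀ x, ∃ p, IsNearest X x p) :
    IsCoarseProj (IsNearest X) (C + 1) (8 * C) := by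
  refine ⟨htot, fun x y p q hp hq hpq => ?_⟩
  obtain ⟨-, f, rfl, hfy, hf, -⟩ := hY x y
  set l := dist (f 0) y
  have hl0 : 0 ≤ l := dist_nonneg
  rw [← hfy] at hq ⊢
  have hcont : ContinuousOn f (Set.Icc 0 l) := by
    have : LipschitzOnWith 1 f (Set.Icc 0 l) :=
      LipschitzOnWith.of_dist_le_mul fun s hs t ht => by
        rw [hf s hs t ht, Real.dist_eq]; simp
    exact this.continuousOn
  set K := {s ∈ Set.Icc 0 l | Metric.infDist (f s) X ≤ C}
  have hKcomp : IsCompact K := by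
    have hcl : IsClosed (Set.Icc 0 l ∩ (fun s => Metric.infDist (f s) X) ⁻¹' Set.Iic C) :=
      ContinuousOn.preimage_isClosed_of_isClosed
        ((Metric.continuous_infDist_pt X).comp_continuousOn hcont) isClosed_Icc isClosed_Iic
    exact isCompact_Icc.of_isClosed_subset hcl fun s hs => hs.1
  have hKne : K.Nonempty := by
    by_contra h
    rw [Set.not_nonempty_iff_eq_empty] at h
    have := hX.dist_le_of_far hC hl0 hf (fun s hs => by
      by_contra! hlt
      have : s ∈ K := ⟨hs, hlt.le⟩
      simp [h] at this) hp hq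
    linarith
  have hnear : ∀ {s r}, s ∈ K → IsNearest X (f s) r → dist (f s) r ≤ C := fun hs hr => by
    rw [hr.dist_eq_infDist]; exact hs.2
  have hlip : ∀ s ∈ Set.Icc 0 l, ∀ t ∈ Set.Icc 0 l,
      Metric.infDist (f s) X ≤ Metric.infDist (f t) X + |s - t| := fun s hs t ht => by
    rw [← hf s hs t ht]
    exact Metric.infDist_le_infDist_add_dist
  obtain ⟨a, haK, ha⟩ := hKcomp.exists_isLeast hKne
  obtain ⟨b, hbK, hb⟩ := hKcomp.exists_isGreatest hKne
  have hab : a ≤ b := ha hbK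
  have hap : dist (f a) p ≤ 2 * C := by
    rcases haK.1.1.eq_or_lt with h0 | h0
    · rw [← h0] at haK ⊢
      linarith [hnear haK hp]
    obtain ⟨r, hr⟩ := htot (f a)
    have hlt : ∀ s ∈ Set.Ico 0 a, C ≤ Metric.infDist (f s) X := fun s hs => by
      by_contra! h
      exact absurd (ha (show s ∈ K from ⟨⟨hs.1, by linarith [hs.2, haK.1.2]⟩, h.le⟩))
        (not_le.2 hs.2)
    have hfar : ∀ s ∈ Set.Icc 0 a, C ≤ Metric.infDist (f s) X := fun s hs => by
      rcases hs.2.eq_or_lt with rfl | h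
      · refine le_of_forall_pos_le_add fun ε hε => ?_
        have hm : max 0 (s - ε) ∈ Set.Ico 0 s :=
          ⟨le_max_left _ _, max_lt h0 (by linarith)⟩
        have h1 := hlip _ ⟨hm.1, hm.2.le.trans haK.1.2⟩ s haK.1
        rw [abs_sub_comm, abs_of_nonneg (by linarith [hm.2])] at h1
        linarith [hlt _ hm, le_max_right 0 (s - ε)]
      · exact hlt s ⟨hs.1, h⟩
    have := hX.dist_le_of_far hC haK.1.1 (fun s hs t ht => hf s
      ⟨hs.1, hs.2.trans haK.1.2⟩ t ⟨ht.1, ht.2.trans haK.1.2⟩) hfar hp hr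
    linarith [hnear haK hr, dist_triangle (f a) r p, dist_comm r p]
  have hbq : dist (f b) q ≤ 2 * C := by
    rcases hbK.1.2.eq_or_lt with h0 | h0
    · rw [← h0] at hq
      linarith [hnear hbK hq]
    obtain ⟨r, hr⟩ := htot (f b)
    have hlt : ∀ s ∈ Set.Ioc b l, C ≤ Metric.infDist (f s) X := fun s hs => by
      by_contra! h
      exact absurd (hb (show s ∈ K from ⟨⟨by linarith [hs.1, hbK.1.1], hs.2⟩, h.le⟩))
        (not_le.2 hs.1)
    have hfar : ∀ s ∈ Set.Icc b l, C ≤ Metric.infDist (f s) X := fun s hs => by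
      rcases hs.1.eq_or_lt with rfl | h
      · refine le_of_forall_pos_le_add fun ε hε => ?_
        have hm : min l (b + ε) ∈ Set.Ioc b l :=
          ⟨lt_min h0 (by linarith), min_le_left _ _⟩
        have h1 := hlip _ ⟨hbK.1.1.trans hm.1.le, hm.2⟩ b hbK.1
        rw [abs_of_nonneg (by linarith [hm.1])] at h1
        linarith [hlt _ hm, min_le_right l (b + ε)]
      · exact hlt s ⟨h, hs.2⟩
    have := hX.dist_le_of_far hC hbK.1.2 (fun s hs t ht => hf s
      ⟨hbK.1.1.trans hs.1, hs.2⟩ t ⟨hbK.1.1.trans ht.1, ht.2⟩) hfar hr hq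
    linarith [hnear hbK hr, dist_triangle (f b) r q]
  have e1 : dist (f 0) (f a) = a := by
    rw [hf 0 ⟨le_rfl, hl0⟩ a haK.1, abs_sub_comm, sub_zero, abs_of_nonneg haK.1.1]
  have e2 : dist (f a) (f b) = b - a := by
    rw [hf a haK.1 b hbK.1, abs_sub_comm, abs_of_nonneg (by linarith)]
  have e3 : dist (f b) (f l) = l - b := by
    rw [hf b hbK.1 l ⟨hl0, le_rfl⟩, abs_sub_comm, abs_of_nonneg (by linarith [hbK.1.2])]
  have e4 : dist (f 0) (f l) = l := by rw [hfy]
  linarith [dist_triangle (f 0) (f a) p, dist_triangle4 p (f a) (f b) q,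
    dist_triangle q (f b) (f l), dist_comm p (f a), dist_comm q (f b)]

/-- If `o` lies coarsely between `x` and `w`, and `v` lies coarsely between `x` and `w` at
the same distance from `x`, then `v` is close to `o`. -/
lemma IsCoarseProj.dist_le {Y : Type*} [MetricSpace Y] {π : Y → Y → Prop} {L D : ℝ}
    (hπ : IsCoarseProj π L D) (hL : 0 ≤ L) {o x w v px pw : Y} {R E : ℝ}
    (hx : π x px) (hw : π w pw) (hox : R + 2 * L ≤ dist o px) (how : dist o pw ≤ R)
    (hv : dist v w - dist x w ≤ E - dist x v) (hE : 0 ≤ E) :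
    dist v o ≤ |dist x o - dist x v| + (E + D + 2 * R + 2 * L) := by
  obtain ⟨pv, hpv⟩ := hπ.total v
  have hR : 0 ≤ R := dist_nonneg.trans how
  have h1 := le_abs_self (dist x o - dist x v)
  have h2 := neg_abs_le (dist x o - dist x v)
  rcases le_or_gt L (dist pv pw) with h | h
  · have := hπ.detour hpv hw h
    linarith [dist_triangle v pw o, dist_triangle v pv pw, dist_triangle o pw w,
      dist_triangle x o w, dist_comm o pw]
  · have h3 : dist o pv ≤ R + L := by
      linarith [dist_triangle o pw pv, dist_comm pv pw]
    have := hπ.detour hpv hx (by linarith [dist_triangle o pv px])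
    linarith [dist_triangle v pv o, dist_triangle x px pv, dist_triangle x pv o,
      dist_comm o pv, dist_comm x px, dist_comm px pv, dist_comm x v]

/-- If `z` projects far from `o` and far from the projection of `o` under two coarse
projections, the first of which fixes `o`, then the images of the two projections contain
points close to each other and far from `o`. -/
lemma IsCoarseProj.exists_close {Y : Type*} [MetricSpace Y] {π π' : Y → Y → Prop} {L D : ℝ}
    (hπ : IsCoarseProj π L D) (hπ' : IsCoarseProj π' L D) (hL : 0 ≤ L) (hD : 0 ≤ D)
    {o p z a q : Y} {T : ℝ} (ho : π o o) (hp : π' o p) (ha : π z a) (hq : π' z q)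
    (hoa : T + 2 * L + 2 * D + 2 * dist o p ≤ dist o a)
    (hoq : T + 2 * L + 2 * D + 2 * dist o p ≤ dist o q) (hT : 0 < T) :
    ∃ x y u v, π x u ∧ π' y v ∧ dist u v ≤ 2 * D + 2 * L ∧ T ≤ dist o u := by
  have hP : 0 ≤ dist o p := dist_nonneg
  have h1 := hπ.detour ho ha (by linarith)
  have h2 := hπ'.detour hp hq (by linarith [dist_triangle o p q])
  obtain ⟨c, hc⟩ := hπ'.total a
  rw [dist_self] at h1
  have hq' : dist o q + dist q z ≤ dist o z + D := by linarith [dist_triangle o p q]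
  rcases lt_or_ge (dist c p) L with hcp | hcp
  · have := hπ'.detour hc hq (by
      linarith [dist_triangle o p q, dist_triangle p c q, dist_comm c p])
    linarith [dist_triangle a c o, dist_triangle c p o, dist_comm o p, dist_comm o a,
      dist_triangle o p z, dist_triangle p c z, dist_comm c p, dist_triangle c q z]
  have h3 := hπ'.detour hc hp hcp
  rcases le_or_gt L (dist c q) with hcq | hcq
  · have h4 := hπ'.detour hc hq hcq
    refine ⟨z, a, a, c, ha, hc, ?_, by linarith⟩
    linarith [dist_triangle o p z, dist_triangle p c z, dist_triangle c q z, dist_comm c p,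
      dist_comm o p, dist_comm o a]
  have h5 : dist a q + dist q o ≤ dist a o + D + 2 * L := by
    linarith [dist_triangle a c q, dist_triangle q c o, dist_triangle c p o, dist_comm c q]
  obtain ⟨e, he⟩ := hπ.total q
  rcases lt_or_ge (dist e o) L with heo | heo
  · have := hπ.detour he ha (by linarith [dist_triangle o e a, dist_comm e o])
    linarith [dist_triangle q e o, dist_triangle o e z, dist_triangle e a z, dist_comm e o,
      dist_comm q o]
  have h6 := hπ.detour he ho heo
  rw [dist_self] at h6
  rcases le_or_gt L (dist e a) with hea | hea
  · have h7 := hπ.detour he ha hea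
    have h8 : dist e q ≤ 2 * D := by
      linarith [dist_triangle o e z, dist_triangle e a z, dist_comm e o, dist_comm q o,
        dist_comm e q]
    exact ⟨q, z, e, q, he, hq, by linarith, by linarith [dist_triangle o e q]⟩
  · refine ⟨z, z, a, q, ha, hq, ?_, by linarith⟩
    linarith [dist_triangle q e a, dist_triangle a e o, dist_comm e a, dist_comm a q,
      dist_comm a e]

/-! ### Orbits of a proper action -/

lemma ProperAction.finite_dist_le {Y G : Type*} [MetricSpace Y] [Group G] [MulAction G Y]
    (hprop : ProperAction G Y) (o : Y) (r : ℝ) : {g : G | dist o (g • o) ≤ r}.Finite := by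
  refine (hprop (Metric.closedBall o r) Metric.isBounded_closedBall).subset fun g hg => ?_
  refine Set.nonempty_iff_ne_empty.1 ⟨g • o, Set.smul_mem_smul_set ?_, ?_⟩
  · exact Metric.mem_closedBall_self (dist_nonneg.trans hg)
  · rw [Metric.mem_closedBall, dist_comm]
    exact hg

lemma ProperAction.exists_isNearest_cyclicOrbit {Y G : Type*} [MetricSpace Y] [Group G]
    [MulAction G Y] (hprop : ProperAction G Y) (o : Y) (f : G) (x : Y) :
    ∃ p, IsNearest (cyclicOrbit o f) x p := by
  set s := cyclicOrbit o f ∩ {y | dist x y ≤ dist x o}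
  have hs : s.Finite := by
    refine ((hprop.finite_dist_le o (2 * dist x o)).image (· • o)).subset ?_
    rintro _ ⟨⟨n, rfl⟩, hn⟩
    refine ⟨f ^ n, ?_, rfl⟩
    have hn' : dist x (f ^ n • o) ≤ dist x o := hn
    change dist o (f ^ n • o) ≤ _
    linarith [dist_triangle o x (f ^ n • o), dist_comm o x]
  have ho : o ∈ s := ⟨⟨0, by simp⟩, le_refl (dist x o)⟩
  obtain ⟨p, hp, hmin⟩ := s.exists_min_image (dist x) hs ⟨o, ho⟩
  refine ⟨p, hp.1, fun a ha => ?_⟩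
  by_cases hax : dist x a ≤ dist x o
  · exact hmin a ⟨ha, hax⟩
  · exact (hmin o ho).trans (not_le.1 hax).le

lemma IsCoarseProj.smul {Y G : Type*} [MetricSpace Y] [Group G] [MulAction G Y]
    (hiso : IsometricAction G Y) {π : Y → Y → Prop} {L D : ℝ} (hπ : IsCoarseProj π L D)
    (t : G) : IsCoarseProj (fun x p => π (t • x) (t • p)) L D := by
  have ht : ∀ x y : Y, dist (t • x) (t • y) = dist x y := (hiso t).dist_eq
  refine ⟨fun x => ?_, fun x y p q hp hq hpq => ?_⟩
  · obtain ⟨p, hp⟩ := hπ.total (t • x)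
    exact ⟨t⁻¹ • p, by simpa using hp⟩
  · have := hπ.detour hp hq (by rwa [ht])
    simpa only [ht] using this

lemma IsNearest.zpow_smul {Y G : Type*} [MetricSpace Y] [Group G] [MulAction G Y]
    (hiso : IsometricAction G Y) {o : Y} {f : G} {x p : Y}
    (h : IsNearest (cyclicOrbit o f) x p) (k : ℤ) :
    IsNearest (cyclicOrbit o f) (f ^ k • x) (f ^ k • p) := by
  obtain ⟨⟨n, rfl⟩, hmin⟩ := h
  refine ⟨⟨k + n, by rw [zpow_add, mul_smul]⟩, ?_⟩
  rintro _ ⟨m, rfl⟩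
  have := hmin (f ^ (m - k) • o) ⟨_, rfl⟩
  rw [(hiso (f ^ k)).dist_eq]
  refine this.trans_eq ?_
  rw [← (hiso (f ^ k)).dist_eq, smul_smul, ← zpow_add, add_sub_cancel]

/-- If every `t` is of the form `fⁿ b f⁻ᵐ`, with `b` in a fixed finite set, for infinitely
many `n`, then `⟨f⟩` has finite index. -/
lemma index_zpowers_ne_zero {G : Type*} [Group G] (f : G) {B : Set G} (hB : B.Finite)
    (h : ∀ t : G, {n : ℤ | ∃ m : ℤ, f ^ (-n) * t * f ^ m ∈ B}.Infinite) :
    (Subgroup.zpowers f).index ≠ 0 := by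
  set H := Subgroup.zpowers f
  let good : Set G := {b | ∃ k m : ℤ, k ≠ 0 ∧ f ^ k * b = b * f ^ m}
  have hfin : ∀ b ∈ good, {c : G ⧸ H | ∃ n : ℤ, c = ((f ^ n * b : G) : G ⧸ H)}.Finite := by
    rintro b ⟨k, m, hk, hkm⟩
    refine ((Set.finite_Ico 0 |k|).image fun n : ℤ => ((f ^ n * b : G) : G ⧸ H)).subset ?_
    rintro _ ⟨n, rfl⟩
    refine ⟨n % k, ⟨Int.emod_nonneg n hk, Int.emod_lt_abs n hk⟩, ?_⟩
    have hsemi : SemiconjBy b (f ^ m) (f ^ k) := hkm.symm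
    refine QuotientGroup.eq.2 ⟨m * (n / k), ?_⟩
    have h1 : f ^ n * b = f ^ (n % k) * b * f ^ (m * (n / k)) := by
      rw [mul_assoc, zpow_mul, (hsemi.zpow_right (n / k)).eq, ← zpow_mul, ← mul_assoc,
        ← zpow_add, Int.emod_add_mul_ediv]
    rw [h1, inv_mul_cancel_left]
  have huniv : (Set.univ : Set (G ⧸ H)) ⊆
      ⋃ b ∈ B ∩ good, {c : G ⧸ H | ∃ n : ℤ, c = ((f ^ n * b : G) : G ⧸ H)} := by
    intro c _
    obtain ⟨t, rfl⟩ := QuotientGroup.mk_surjective c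
    choose! m hm using fun (n : ℤ) (hn : n ∈ {n : ℤ | ∃ m : ℤ, f ^ (-n) * t * f ^ m ∈ B}) => hn
    obtain ⟨n, hn, n', hn', hne, heq⟩ := (h t).exists_ne_map_eq_of_mapsTo hm hB
    refine Set.mem_biUnion (x := f ^ (-n) * t * f ^ m n)
      ⟨hm n hn, n - n', m n - m n', sub_ne_zero.2 hne, ?_⟩ ⟨n, QuotientGroup.eq.2 ⟨m n, ?_⟩⟩
    · conv_rhs => rw [heq]
      group
    · group
  have : Finite (G ⧸ H) := Set.finite_univ_iff.1
    (((hB.inter_of_left good).biUnion fun b hb => hfin b hb.2).subset huniv)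
  exact Subgroup.index_ne_zero_of_finite

/-! ### Horofunctions -/

lemma continuous_horoAct {Y G : Type*} [MetricSpace Y] [Group G] [MulAction G Y]
    [ContinuousConstSMul G Y] (o : Y) (g : G) : Continuous (horoAct o g) :=
  (ContinuousMap.continuous_precomp ⟨fun y : Y => g⁻¹ • y, continuous_const_smul g⁻¹⟩).sub
    (ContinuousMap.continuous_const'.comp (continuous_eval_const (g⁻¹ • o)))

lemma horoAct_busemannCM {Y G : Type*} [MetricSpace Y] [Group G] [MulAction G Y]
    [ContinuousConstSMul G Y] (hiso : IsometricAction G Y) (o z : Y) (g : G) :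
    horoAct o g (busemannCM o z) = busemannCM o (g • z) := by
  have h : ∀ y : Y, dist (g⁻¹ • y) z = dist y (g • z) := fun y => by
    rw [← (hiso g).dist_eq, smul_inv_smul]
  ext y
  simp [horoAct, busemannCM, h]

lemma sub_le_of_mem_closure_busemannCM {Y : Type*} [MetricSpace Y] {o : Y} {Z : Set Y}
    {ξ : C(Y, ℝ)} (hξ : ξ ∈ closure (busemannCM o '' Z)) {u v : Y} {E : ℝ}
    (h : ∀ z ∈ Z, dist v z - dist u z ≤ E) : ξ v - ξ u ≤ E := by
  have hcl : IsClosed {φ : C(Y, ℝ) | φ v - φ u ≤ E} :=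
    isClosed_le ((continuous_eval_const v).sub
      (continuous_eval_const u)) continuous_const
  refine closure_minimal ?_ hcl hξ
  rintro _ ⟨z, hz, rfl⟩
  simpa only [Set.mem_ofPred_eq, busemannCM, ContinuousMap.coe_mk, sub_sub_sub_cancel_right]
    using h z hz

lemma exists_dist_sub_dist_lt {Y : Type*} [MetricSpace Y] {o : Y} {Z : Set Y}
    {ξ : C(Y, ℝ)} (hξ : ξ ∈ closure (busemannCM o '' Z)) {u v : Y} {E : ℝ}
    (h : ξ v - ξ u < E) : ∃ z ∈ Z, dist v z - dist u z < E := by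
  have hop : IsOpen {φ : C(Y, ℝ) | φ v - φ u < E} :=
    isOpen_lt ((continuous_eval_const v).sub
      (continuous_eval_const u)) continuous_const
  obtain ⟨_, hz, z, hzZ, rfl⟩ := mem_closure_iff.1 hξ _ hop h
  exact ⟨z, hzZ, by
    simpa only [Set.mem_ofPred_eq, busemannCM, ContinuousMap.coe_mk, sub_sub_sub_cancel_right]
      using hz⟩

lemma IsConformalDensity.le_measure_preimage {Y G : Type*} [MetricSpace Y] [Group G]
    [MulAction G Y] [ContinuousConstSMul G Y] [MeasurableSpace C(Y, ℝ)] [BorelSpace C(Y, ℝ)]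
    (hiso : IsometricAction G Y) {o : Y} {ω : ℝ} (hω : 0 ≤ ω) {μ : Y → Measure C(Y, ℝ)}
    (hμ : IsConformalDensity G o ω μ) (Z : Set Y) (g : G) :
    ENNReal.ofReal (Real.exp (-ω * dist o (g • o))) * μ o (closure (busemannCM o '' Z)) ≤
      μ o (horoAct o g⁻¹ ⁻¹' closure (busemannCM o '' Z)) := by
  obtain ⟨-, -, -, hmap, hdens⟩ := hμ
  have hS : MeasurableSet (closure (busemannCM o '' Z)) := isClosed_closure.measurableSet
  rw [← Measure.map_apply (continuous_horoAct o g⁻¹).measurable hS, hmap,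
    hdens (g⁻¹ • o) o, withDensity_apply _ hS, ← setLIntegral_const]
  refine setLIntegral_mono' hS fun ξ hξ => ENNReal.ofReal_le_ofReal (Real.exp_le_exp.2 ?_)
  have hd : dist o (g • o) = dist (g⁻¹ • o) o := by
    rw [← (hiso g).dist_eq (g⁻¹ • o), smul_inv_smul]
  have := sub_le_of_mem_closure_busemannCM hξ (u := o) (v := g⁻¹ • o)
    (E := dist o (g • o)) fun z _ => by
      rw [hd]; linarith [dist_triangle (g⁻¹ • o) o z]
  nlinarith

lemma IsConformalDensity.measure_preimage_eq_zero {Y G : Type*} [MetricSpace Y] [Group G]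
    [MulAction G Y] [ContinuousConstSMul G Y] [MeasurableSpace C(Y, ℝ)] [BorelSpace C(Y, ℝ)]
    {o : Y} {ω : ℝ} {μ : Y → Measure C(Y, ℝ)} (hμ : IsConformalDensity G o ω μ)
    {S : Set C(Y, ℝ)} (hS : MeasurableSet S) (h0 : μ o S = 0) (g : G) :
    μ o (horoAct o g ⁻¹' S) = 0 := by
  obtain ⟨-, -, -, hmap, hdens⟩ := hμ
  rw [← Measure.map_apply (continuous_horoAct o g).measurable hS, hmap, hdens (g • o) o]
  exact withDensity_absolutelyContinuous _ _ h0

/-- The points with a nearest point in `X` at distance at most `r` from `o`. -/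
def nearSet {Y : Type*} [MetricSpace Y] (X : Set Y) (o : Y) (r : ℝ) : Set Y :=
  {z | ∃ p, IsNearest X z p ∧ dist o p ≤ r}

/-- A conformal density gives positive mass to the horofunctions which project to a bounded
part of the axis of a contracting element. -/
lemma IsConformalDensity.exists_measure_ne_zero {Y G : Type*} [MetricSpace Y] [Group G]
    [MulAction G Y] [Countable G] [ContinuousConstSMul G Y] [MeasurableSpace C(Y, ℝ)]
    [BorelSpace C(Y, ℝ)] (hiso : IsometricAction G Y) (hprop : ProperAction G Y)
    (hne : NonElementary G) {o : Y} {f : G} {L D : ℝ} (hL : 0 ≤ L) (hD : 0 ≤ D)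
    (hπ : IsCoarseProj (IsNearest (cyclicOrbit o f)) L D) {ω : ℝ}
    {μ : Y → Measure C(Y, ℝ)} (hμ : IsConformalDensity G o ω μ) :
    ∃ r : ℕ, μ o (closure (busemannCM o '' nearSet (cyclicOrbit o f) o r)) ≠ 0 := by
  by_contra! h0
  set A := cyclicOrbit o f
  set S : ℕ → Set C(Y, ℝ) := fun r => closure (busemannCM o '' nearSet A o r)
  have hnull : μ o ({ξ | ¬ IsHoroPoint o ξ} ∪ ((⋃ r, S r) ∪
      ⋃ t : G, ⋃ r, horoAct o t ⁻¹' S r)) = 0 := by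
    refine measure_union_null (hμ.2.1 o) (measure_union_null (measure_iUnion_null h0)
      (measure_iUnion_null fun t => measure_iUnion_null fun r => ?_))
    exact hμ.measure_preimage_eq_zero isClosed_closure.measurableSet (h0 r) t
  obtain ⟨η, hη⟩ : ∃ η, η ∉ {ξ | ¬ IsHoroPoint o ξ} ∪ ((⋃ r, S r) ∪
      ⋃ t : G, ⋃ r, horoAct o t ⁻¹' S r) := by
    by_contra! hall
    rw [Set.eq_univ_of_forall hall, hμ.2.2.1] at hnull
    exact one_ne_zero hnull
  simp only [Set.mem_union, Set.mem_ofPred_eq, Set.mem_iUnion, Set.mem_preimage, not_or,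
    not_not, not_exists] at hη
  obtain ⟨⟨hcl, -⟩, h1, h2⟩ := hη
  have hfar : ∀ (t : G) (r : ℕ), ∃ z : Y, (∀ p, IsNearest A z p → r < dist o p) ∧
      ∀ p, IsNearest A (t • z) p → r < dist o p := by
    intro t r
    obtain ⟨_, ⟨hz1, hz2⟩, z, rfl⟩ := mem_closure_iff.1 hcl ((S r)ᶜ ∩ horoAct o t ⁻¹' (S r)ᶜ)
      (isClosed_closure.isOpen_compl.inter
        (isClosed_closure.isOpen_compl.preimage (continuous_horoAct o t))) ⟨h1 r, h2 t r⟩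
    rw [Set.mem_preimage, horoAct_busemannCM hiso] at hz2
    refine ⟨z, fun p hp => ?_, fun p hp => ?_⟩ <;> by_contra! hle
    · exact hz1 (subset_closure ⟨z, ⟨p, hp, hle⟩, rfl⟩)
    · exact hz2 (subset_closure ⟨t • z, ⟨p, hp, hle⟩, rfl⟩)
  refine hne _ (index_zpowers_ne_zero f (hprop.finite_dist_le o (2 * D + 2 * L)) ?_) f rfl
  intro t hfin
  obtain ⟨b, hb⟩ := (hfin.image fun n : ℤ => dist o (f ^ n • o)).bddAbove
  have ho : IsNearest A o o := ⟨⟨0, by simp⟩, fun a _ => by simp⟩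
  have hπ' := hπ.smul hiso t⁻¹
  obtain ⟨p, hp⟩ := hπ'.total o
  set T := max b 0 + 1 with hT
  obtain ⟨r, hr⟩ := exists_nat_ge (T + 2 * L + 2 * D + 2 * dist o p + dist o (t⁻¹ • o))
  obtain ⟨z, hz1, hz2⟩ := hfar t⁻¹ r
  obtain ⟨a, ha⟩ := hπ.total z
  obtain ⟨q, hq⟩ := hπ'.total z
  have hoq : (r : ℝ) - dist o (t⁻¹ • o) ≤ dist o q := by
    have := (hiso t⁻¹).dist_eq o q
    linarith [hz2 _ hq, dist_triangle o (t⁻¹ • o) (t⁻¹ • q)]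
  obtain ⟨x, y, u, v, ⟨⟨n, rfl⟩, -⟩, ⟨⟨m, hm⟩, -⟩, huv, hTu⟩ :=
    hπ.exists_close hπ' hL hD ho hp ha hq
      (by linarith [hz1 a ha, dist_nonneg (x := o) (y := t⁻¹ • o)]) (by linarith)
      (show 0 < T by positivity)
  have hbn := hb (Set.mem_image_of_mem _ (show n ∈ {n : ℤ | _} from ⟨m, ?_⟩))
  · linarith [le_max_left b 0]
  · rw [inv_smul_eq_iff] at hm
    rw [hm, ← (hiso (f ^ (-n))).dist_eq] at huv
    simpa [mul_smul] using huv

/-! ### Counting -/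

lemma card_mul_le_of_overlap {Ω ι : Type*} [MeasurableSpace Ω] {ν : Measure Ω}
    (hν : ν Set.univ = 1) (F : Finset ι) {S : ι → Set Ω} (hS : ∀ i, MeasurableSet (S i))
    {c : ENNReal} (hc : ∀ i ∈ F, c ≤ ν (S i)) {M : ℕ}
    (hM : ∀ x, {i | i ∈ F ∧ x ∈ S i}.ncard ≤ M) : F.card * c ≤ M := by
  classical
  calc (F.card : ENNReal) * c = ∑ _i ∈ F, c := by rw [Finset.sum_const, nsmul_eq_mul]
    _ ≤ ∑ i ∈ F, ν (S i) := Finset.sum_le_sum hc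
    _ = ∫⁻ x, ∑ i ∈ F, (S i).indicator 1 x ∂ν := by
      rw [lintegral_finsetSum _ fun i _ => measurable_one.indicator (hS i)]
      exact Finset.sum_congr rfl fun i _ => (lintegral_indicator_one (hS i)).symm
    _ ≤ ∫⁻ _x, M ∂ν := lintegral_mono fun x => by
      have hset : {i | i ∈ F ∧ x ∈ S i} = (F.filter fun i => x ∈ S i : Finset ι) := by
        ext; simp
      have := hM x
      rw [hset, Set.ncard_coe_finset] at this
      simp only [Set.indicator_apply, Pi.one_apply, Finset.sum_boole]
      exact_mod_cast this
    _ = M := by rw [lintegral_const, hν, mul_one]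

/-- An exponential bound on unit annuli yields an exponential bound on balls. -/
lemma exists_card_le_exp {ι : Type*} {l : ι → ℝ} (hl : ∀ i, 0 ≤ l i) {s : Set ι} {ω K : ℝ}
    (hω : 0 < ω)
    (hK : ∀ (n : ℕ) (F : Finset ι), (∀ i ∈ F, i ∈ s ∧ n ≤ l i ∧ l i < n + 1) →
      (F.card : ℝ) ≤ K * Real.exp (ω * n)) :
    ∃ K', 0 < K' ∧ ∀ R, 0 ≤ R → ∀ F : Finset ι, (∀ i ∈ F, i ∈ s ∧ l i ≤ R) →
      (F.card : ℝ) ≤ K' * Real.exp (ω * R) := by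
  classical
  have hK0 : 0 ≤ K := by simpa using hK 0 ∅ (by simp)
  have he : 0 < Real.exp ω - 1 := by linarith [Real.add_one_lt_exp hω.ne']
  refine ⟨K * (Real.exp ω / (Real.exp ω - 1)) + 1, by positivity, fun R hR F hF => ?_⟩
  have hmaps : ∀ i ∈ F, ⌊l i⌋₊ ∈ Finset.range (⌊R⌋₊ + 1) := fun i hi =>
    Finset.mem_range.2 (Nat.lt_succ_of_le (Nat.floor_le_floor (hF i hi).2))
  have hgeom : ∑ n ∈ Finset.range (⌊R⌋₊ + 1), Real.exp (ω * n) ≤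
      Real.exp ω / (Real.exp ω - 1) * Real.exp (ω * R) := by
    have hpow : ∀ n : ℕ, Real.exp (ω * n) = Real.exp ω ^ n := fun n => by
      rw [mul_comm, Real.exp_nat_mul]
    simp only [hpow]
    rw [geom_sum_eq (by linarith), div_mul_eq_mul_div]
    refine div_le_div_of_nonneg_right ?_ he.le
    rw [pow_succ, ← hpow, mul_comm (Real.exp ω)]
    have : Real.exp (ω * ⌊R⌋₊) ≤ Real.exp (ω * R) :=
      Real.exp_le_exp.2 (mul_le_mul_of_nonneg_left (Nat.floor_le hR) hω.le)
    nlinarith [Real.exp_pos ω]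
  calc (F.card : ℝ)
      = ∑ n ∈ Finset.range (⌊R⌋₊ + 1), ((F.filter fun i => ⌊l i⌋₊ = n).card : ℝ) := by
        rw [Finset.card_eq_sum_card_fiberwise hmaps, Nat.cast_sum]
    _ ≤ ∑ n ∈ Finset.range (⌊R⌋₊ + 1), K * Real.exp (ω * n) := by
      refine Finset.sum_le_sum fun n _ => hK n _ fun i hi => ?_
      obtain ⟨hiF, rfl⟩ := Finset.mem_filter.1 hi
      exact ⟨(hF i hiF).1, Nat.floor_le (hl i), Nat.lt_floor_add_one _⟩
    _ ≤ K * (Real.exp ω / (Real.exp ω - 1) * Real.exp (ω * R)) := by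
      rw [← Finset.mul_sum]
      exact mul_le_mul_of_nonneg_left hgeom hK0
    _ ≤ (K * (Real.exp ω / (Real.exp ω - 1)) + 1) * Real.exp (ω * R) := by
      nlinarith [Real.exp_pos (ω * R)]

/-- The annular orbit count, restricted to the elements `g` such that `g⁻¹ o` projects far
from `o`. -/
lemma IsConformalDensity.exists_card_annulus_le {Y G : Type*} [MetricSpace Y] [Group G]
    [MulAction G Y] [ContinuousConstSMul G Y] [MeasurableSpace C(Y, ℝ)]
    [BorelSpace C(Y, ℝ)] (hiso : IsometricAction G Y) (hprop : ProperAction G Y)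
    {o : Y} {X : Set Y} {L D : ℝ} (hL : 0 ≤ L) (hD : 0 ≤ D)
    (hπ : IsCoarseProj (IsNearest X) L D) {ω : ℝ} (hω : 0 ≤ ω)
    {μ : Y → Measure C(Y, ℝ)} (hμ : IsConformalDensity G o ω μ) {r : ℕ}
    (hr : μ o (closure (busemannCM o '' nearSet X o r)) ≠ 0) :
    ∃ K : ℝ, ∀ (n : ℕ) (F : Finset G),
      (∀ g ∈ F, g ∈ {g : G | ∃ p, IsNearest X (g⁻¹ • o) p ∧ r + 2 * L ≤ dist o p} ∧
        n ≤ dist o (g • o) ∧ dist o (g • o) < n + 1) →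
      (F.card : ℝ) ≤ K * Real.exp (ω * n) := by
  set Z := nearSet X o r
  set E : ℝ := D + 2 * r with hE
  have hfinB := hprop.finite_dist_le o (1 + (E + 1 + D + 2 * r + 2 * L))
  set B := {g : G | dist o (g • o) ≤ 1 + (E + 1 + D + 2 * r + 2 * L)}
  have hinv : ∀ g h : G, dist (g⁻¹ • o) (g⁻¹ • h • o) = dist o (h • o) := fun g h =>
    (hiso g⁻¹).dist_eq _ _
  have hinv' : ∀ g : G, dist (g⁻¹ • o) o = dist o (g • o) := fun g => by
    rw [← hinv g g, inv_smul_smul]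
  have hshadow : ∀ g : G, (∃ p, IsNearest X (g⁻¹ • o) p ∧ r + 2 * L ≤ dist o p) →
      ∀ η, horoAct o g⁻¹ η ∈ closure (busemannCM o '' Z) →
      η (g • o) - η o ≤ E - dist o (g • o) := by
    rintro g ⟨p, hp, hop⟩ η hη
    have hL' : ∀ w ∈ Z, dist o w - dist (g⁻¹ • o) w ≤ E - dist o (g • o) := by
      rintro w ⟨q, hq, hoq⟩
      have := hπ.detour hp hq (by linarith [dist_triangle o q p, dist_comm p q])
      rw [← hinv']
      linarith [dist_triangle (g⁻¹ • o) p o, dist_triangle p q o, dist_triangle o q w,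
        dist_comm o q]
    simpa [horoAct] using sub_le_of_mem_closure_busemannCM hη hL'
  refine ⟨B.ncard / (μ o (closure (busemannCM o '' Z))).toReal * Real.exp ω,
    fun n F hF => ?_⟩
  have := hμ.1 o
  have hpos := ENNReal.toReal_pos hr (measure_ne_top _ _)
  have hcount := card_mul_le_of_overlap hμ.2.2.1 F (M := B.ncard)
    (S := fun g => horoAct o g⁻¹ ⁻¹' closure (busemannCM o '' Z))
    (c := ENNReal.ofReal (Real.exp (-ω * (n + 1))) * μ o (closure (busemannCM o '' Z)))
    (fun g => isClosed_closure.measurableSet.preimage (continuous_horoAct o g⁻¹).measurable)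
    (fun g hg => ?_) (fun η => ?_)
  · have hreal := ENNReal.toReal_mono (ENNReal.natCast_ne_top _) hcount
    rw [ENNReal.toReal_mul, ENNReal.toReal_mul, ENNReal.toReal_natCast,
      ENNReal.toReal_natCast, ENNReal.toReal_ofReal (Real.exp_pos _).le] at hreal
    rw [mul_assoc, ← Real.exp_add, div_mul_eq_mul_div, le_div_iff₀ hpos]
    have hexp : Real.exp (-ω * (n + 1)) * Real.exp (ω + ω * n) = 1 := by
      rw [← Real.exp_add, Real.exp_eq_one_iff]; ring
    calc (F.card : ℝ) * (μ o (closure (busemannCM o '' Z))).toReal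
        = F.card * (Real.exp (-ω * (n + 1)) * (μ o (closure (busemannCM o '' Z))).toReal) *
          Real.exp (ω + ω * n) := by linear_combination (-(F.card : ℝ) *
            (μ o (closure (busemannCM o '' Z))).toReal) * hexp
      _ ≤ B.ncard * Real.exp (ω + ω * n) :=
        mul_le_mul_of_nonneg_right hreal (Real.exp_pos _).le
  · refine le_trans ?_ (hμ.le_measure_preimage hiso hω Z g)
    gcongr ENNReal.ofReal (Real.exp ?_) * _
    nlinarith [(hF g hg).2.2]
  · rcases Set.eq_empty_or_nonempty
      {g | g ∈ F ∧ η ∈ horoAct o g⁻¹ ⁻¹' closure (busemannCM o '' Z)} with h | ⟨g, hg, hgη⟩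
    · rw [h, Set.ncard_empty]
      exact Nat.zero_le _
    refine Set.ncard_le_ncard_of_injOn (g⁻¹ * ·) ?_ (mul_right_injective g⁻¹).injOn hfinB
    rintro g' ⟨hg', hg'η⟩
    obtain ⟨⟨p, hp, hop⟩, hg1, hg2⟩ := hF g hg
    obtain ⟨hG', hg'1, hg'2⟩ := hF g' hg'
    have hb := hshadow g' hG' η hg'η
    have hb' : horoAct o g⁻¹ η (g⁻¹ • g' • o) - horoAct o g⁻¹ η (g⁻¹ • o) <
        E + 1 - dist (g⁻¹ • o) (g⁻¹ • g' • o) := by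
      rw [hinv]
      simp only [horoAct, ContinuousMap.coe_mk, inv_inv, smul_inv_smul,
        sub_sub_sub_cancel_right]
      linarith
    obtain ⟨w, ⟨q, hq, hoq⟩, hw⟩ := exists_dist_sub_dist_lt hgη hb'
    have hmain := hπ.dist_le hL hp hq hop hoq hw.le (by positivity)
    rw [hinv, hinv'] at hmain
    change dist o ((g⁻¹ * g') • o) ≤ _
    rw [mul_smul, dist_comm]
    have : |dist o (g • o) - dist o (g' • o)| ≤ 1 := abs_le.2 ⟨by linarith, by linarith⟩
    linarith

lemma critExp_le_of_orbitCount_le {Y G : Type*} [MetricSpace Y] [Group G] [MulAction G Y]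
    (hprop : ProperAction G Y) {o : Y} {ω K : ℝ} (hK : 0 < K)
    (h : ∀ R : ℝ, 0 ≤ R →
      (orbitCount G o (Set.univ : Set G) R : ℝ) ≤ K * Real.exp (ω * R)) :
    critExp G o (Set.univ : Set G) ≤ ω := by
  have hone : ∀ R : ℝ, 0 ≤ R → 1 ≤ orbitCount G o (Set.univ : Set G) R := fun R hR => by
    have : Finite {g : G // g ∈ (Set.univ : Set G) ∧ dist o (g • o) ≤ R} :=
      (hprop.finite_dist_le o R).subset fun g hg => hg.2
    have : Nonempty {g : G // g ∈ (Set.univ : Set G) ∧ dist o (g • o) ≤ R} :=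
      ⟨1, Set.mem_univ _, by simpa using hR⟩
    exact Nat.card_pos
  have hcob : IsCoboundedUnder (· ≤ ·) atTop
      fun R : ℝ => Real.log (orbitCount G o (Set.univ : Set G) R) / R := by
    refine IsBoundedUnder.isCoboundedUnder_le ⟨0, eventually_map.2 ?_⟩
    filter_upwards [eventually_ge_atTop 0] with R hR
    exact div_nonneg (Real.log_nonneg (by exact_mod_cast hone R hR)) hR
  have hlim : Tendsto (fun R : ℝ => Real.log K / R + ω) atTop (𝓝 ω) := by
    simpa using (tendsto_const_nhds.div_atTop tendsto_id).add_const ω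
  refine le_of_forall_pos_le_add fun ε hε => limsup_le_of_le hcob ?_
  filter_upwards [eventually_gt_atTop 0, hlim.eventually_lt_const (lt_add_of_pos_right ω hε)]
    with R hR hlt
  refine le_trans ?_ hlt.le
  have hpos : (0 : ℝ) < orbitCount G o (Set.univ : Set G) R := by
    exact_mod_cast hone R hR.le
  have := Real.log_le_log hpos (h R hR.le)
  rw [Real.log_mul hK.ne' (Real.exp_pos _).ne', Real.log_exp] at this
  rw [div_add' _ _ _ hR.ne']
  exact div_le_div_of_nonneg_right this hR.le

/-- the existence of an `ω`-dimensional conformal density implies purely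
exponential upper bound `#N(o,R) ≤ K e^{ωR}` on the orbit growth; in particular `ω ≥ ω_G`. -/
theorem statement17 {Y G : Type*} [MetricSpace Y] [ProperSpace Y]
    [Group G] [MulAction G Y] [Countable G] [ContinuousConstSMul G Y]
    [MeasurableSpace C(Y, ℝ)] [BorelSpace C(Y, ℝ)]
    (hY : GeodesicSpace Y) (hiso : IsometricAction G Y)
    (hprop : ProperAction G Y) (hne : NonElementary G) (o : Y)
    (hcontr : ∃ f : G, IsContractingEltAny o f)
    (ω : ℝ) (hω : 0 < ω) (μ : Y → MeasureTheory.Measure C(Y, ℝ))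
    (hμ : IsConformalDensity G o ω μ) :
    (∃ K : ℝ, 0 < K ∧ ∀ R : ℝ, 0 ≤ R →
      (orbitCount G o (Set.univ : Set G) R : ℝ) ≤ K * Real.exp (ω * R)) ∧
    critExp G o (Set.univ : Set G) ≤ ω := by
  classical
  obtain ⟨f, C, hC, -, ⟨c, hc, hqi⟩, hf⟩ := hcontr
  have hπ := hf.isCoarseProj hY (by linarith) (hprop.exists_isNearest_cyclicOrbit o f)
  have hL : 0 ≤ C + 1 := by linarith
  have hD : 0 ≤ 8 * C := by linarith
  obtain ⟨r, hr⟩ := hμ.exists_measure_ne_zero hiso hprop hne hL hD hπ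
  obtain ⟨K, hK⟩ := hμ.exists_card_annulus_le hiso hprop hL hD hπ hω.le hr
  obtain ⟨Θ, hΘ⟩ : ∃ Θ : ℝ, r + 2 * (C + 1) = Θ := ⟨_, rfl⟩
  rw [hΘ] at hK
  obtain ⟨K', hK', hball⟩ := exists_card_le_exp (fun g : G => dist_nonneg) hω hK
  set far := {g : G | ∃ p, IsNearest (cyclicOrbit o f) (g⁻¹ • o) p ∧ Θ ≤ dist o p}
  obtain ⟨k, hk⟩ : ∃ k : ℕ, 2 * Θ ≤ dist o (f ^ (-(k : ℤ)) • o) := by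
    obtain ⟨k, hk⟩ := exists_nat_ge (c * (2 * Θ + c))
    refine ⟨k, ?_⟩
    have h1 := (hqi 0 (-(k : ℤ))).1
    have h2 : 2 * Θ + c ≤ 1 / c * k := by
      rw [one_div, ← div_eq_inv_mul, le_div_iff₀ (by linarith), mul_comm]
      exact hk
    simp only [zpow_zero, one_smul, Int.cast_zero, Int.cast_neg, Int.cast_natCast, zero_sub,
      neg_neg, Nat.abs_cast] at h1
    linarith
  have hshift : ∀ g : G, g ∉ far → g * f ^ (k : ℤ) ∈ far := fun g hg => by
    obtain ⟨p, hp⟩ := hπ.total (g⁻¹ • o)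
    have hop : dist o p < Θ := by
      by_contra! h
      exact hg ⟨p, hp, h⟩
    refine ⟨f ^ (-(k : ℤ)) • p, ?_, ?_⟩
    · rw [mul_inv_rev, ← zpow_neg, mul_smul]
      exact hp.zpow_smul hiso _
    · have := (hiso (f ^ (-(k : ℤ)))).dist_eq o p
      linarith [dist_triangle o (f ^ (-(k : ℤ)) • p) (f ^ (-(k : ℤ)) • o),
        dist_comm (f ^ (-(k : ℤ)) • p) (f ^ (-(k : ℤ)) • o)]
  set d := dist o (f ^ (k : ℤ) • o)
  have hd0 : 0 ≤ d := dist_nonneg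
  have hcount : ∀ R : ℝ, 0 ≤ R → (orbitCount G o (Set.univ : Set G) R : ℝ) ≤
      (K' + K' * Real.exp (ω * d)) * Real.exp (ω * R) := fun R hR => by
    set F := (hprop.finite_dist_le o R).toFinset with hF
    have hcard : orbitCount G o (Set.univ : Set G) R = F.card := by
      rw [hF, ← Set.ncard_eq_toFinset_card _ (hprop.finite_dist_le o R), ← Nat.card_coe_set_eq]
      simp only [orbitCount, Set.mem_univ, true_and, Set.coe_ofPred]
    have hmem : ∀ g ∈ F, dist o (g • o) ≤ R := fun g hg => by simpa [hF] using hg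
    have h1 := hball R hR (F.filter (· ∈ far)) fun g hg =>
      ⟨(Finset.mem_filter.1 hg).2, hmem g (Finset.mem_filter.1 hg).1⟩
    have h2 := hball (d + R) (by linarith)
      ((F.filter (· ∉ far)).image (· * f ^ (k : ℤ))) fun g' hg' => by
        obtain ⟨g, hg, rfl⟩ := Finset.mem_image.1 hg'
        refine ⟨hshift g (Finset.mem_filter.1 hg).2, ?_⟩
        have h3 := hmem g (Finset.mem_filter.1 hg).1
        have h4 := (hiso g).dist_eq o (f ^ (k : ℤ) • o)
        rw [mul_smul]
        linarith [dist_triangle o (g • o) (g • f ^ (k : ℤ) • o)]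
    rw [Finset.card_image_of_injective _ (mul_left_injective _), mul_add, Real.exp_add] at h2
    rw [hcard, ← Finset.card_filter_add_card_filter_not (s := F) (· ∈ far), Nat.cast_add]
    linarith
  have hKpos : 0 < K' + K' * Real.exp (ω * d) := by positivity
  exact ⟨⟨_, hKpos, hcount⟩, critExp_le_of_orbitCount_le hprop hKpos hcount⟩

end ConfDyn
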